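/- The centralizer {v ∈ V : ∀ w ∈ G, ω(v,w) = 0} of the check span equals the F₂-span of the m+n vectors S^X_1, …, S^X_{m−1}, S^Z_1, …, S^Z_{n−1}, X̄_L, Z̄_L, and these m+n vectors are linearly independent. -/

import Mathlib

open Finset

/-- The F₂-vector space of Pauli operators (mod phase) on the m×n grid:
first component is the X-support, second the Z-support. -/
abbrev V (m n : ℕ) := ((Fin m × Fin n) → ZMod 2) × ((Fin m × Fin n) → ZMod 2)

/-- Symplectic form: two Paulis commute iff `omega` of their vectors is 0. -/
def omega {m n : ℕ} (v w : V m n) : ZMod 2 :=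
  ∑ q : Fin m × Fin n, (v.1 q * w.2 q + w.1 q * v.2 q)

/-- Horizontal XX check H(i,j): X-part the indicator of {(i,j),(i+1,j)}
(here i ranges over Fin (m-1), i.e. 0 ≤ i ≤ m−2). -/
def Hcheck {m n : ℕ} (i : Fin (m - 1)) (j : Fin n) : V m n :=
  (fun q => if (q.1.val = i.val ∨ q.1.val = i.val + 1) ∧ q.2 = j then 1 else 0, 0)

/-- Vertical ZZ check W(i,j): Z-part the indicator of {(i,j),(i,j+1)}
(here j ranges over Fin (n-1), i.e. 0 ≤ j ≤ n−2). -/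
def Wcheck {m n : ℕ} (i : Fin m) (j : Fin (n - 1)) : V m n :=
  (0, fun q => if q.1 = i ∧ (q.2.val = j.val ∨ q.2.val = j.val + 1) then 1 else 0)

/-- The F₂-span G of all Bacon-Shor check vectors. -/
def checkSpan (m n : ℕ) : Submodule (ZMod 2) (V m n) :=
  Submodule.span (ZMod 2)
    ((Set.range fun p : Fin (m - 1) × Fin n => Hcheck p.1 p.2) ∪
     (Set.range fun p : Fin m × Fin (n - 1) => Wcheck p.1 p.2))

/-- `omega · w` as a linear map in the first argument. -/
def omegaR {m n : ℕ} (w : V m n) : V m n →ₗ[ZMod 2] ZMod 2 where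
  toFun v := omega v w
  map_add' a b := by
    simp only [omega, Prod.fst_add, Prod.snd_add, Pi.add_apply]
    rw [← Finset.sum_add_distrib]
    exact Finset.sum_congr rfl fun q _ => by ring
  map_smul' c a := by
    simp only [omega, Prod.smul_fst, Prod.smul_snd, Pi.smul_apply, smul_eq_mul,
      RingHom.id_apply, Finset.mul_sum]
    exact Finset.sum_congr rfl fun q _ => by ring

/-- The radical {v ∈ G : ∀ w ∈ G, ω(v,w) = 0} of the symplectic form on G. -/
def radical (m n : ℕ) : Submodule (ZMod 2) (V m n) :=
  checkSpan m n ⊓ ⨅ w ∈ checkSpan m n, LinearMap.ker (omegaR w)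

/-- The centralizer {v ∈ V : ∀ w ∈ G, ω(v,w) = 0} of the check span. -/
def centralizer (m n : ℕ) : Submodule (ZMod 2) (V m n) :=
  ⨅ w ∈ checkSpan m n, LinearMap.ker (omegaR w)

/-- Vertical X-type stabilizer S^X_i (i = 1,…,m−1 encoded as Fin (m-1) via i ↦ i−1):
X-part the indicator of {i−1,i} × Fin n. -/
def SX {m n : ℕ} (i : Fin (m - 1)) : V m n :=
  (fun q => if q.1.val = i.val ∨ q.1.val = i.val + 1 then 1 else 0, 0)

/-- Horizontal Z-type stabilizer S^Z_j (j = 1,…,n−1 encoded as Fin (n-1) via j ↦ j−1):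
Z-part the indicator of Fin m × {j−1,j}. -/
def SZ {m n : ℕ} (j : Fin (n - 1)) : V m n :=
  (0, fun q => if q.2.val = j.val ∨ q.2.val = j.val + 1 then 1 else 0)

/-- Logical X̄_L: X-part the indicator of {0} × Fin n. -/
def XL {m n : ℕ} : V m n :=
  (fun q => if q.1.val = 0 then 1 else 0, 0)

/-- Logical Z̄_L: Z-part the indicator of Fin m × {0}. -/
def ZL {m n : ℕ} : V m n :=
  (0, fun q => if q.2.val = 0 then 1 else 0)

/-- Gauge qubit X̄_{a,b} (1 ≤ a ≤ m−1, 1 ≤ b ≤ n−1, encoded as Fin (m-1) × Fin (n-1)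
via (a,b) ↦ (a−1,b−1)): X-part the indicator of {a−1,a} × {b,…,n−1}. -/
def gaugeX {m n : ℕ} (a : Fin (m - 1)) (b : Fin (n - 1)) : V m n :=
  (fun q => if (q.1.val = a.val ∨ q.1.val = a.val + 1) ∧ b.val + 1 ≤ q.2.val then 1 else 0, 0)

/-- Gauge qubit Z̄_{a,b}: Z-part the indicator of {a,…,m−1} × {b−1,b}. -/
def gaugeZ {m n : ℕ} (a : Fin (m - 1)) (b : Fin (n - 1)) : V m n :=
  (0, fun q => if a.val + 1 ≤ q.1.val ∧ (q.2.val = b.val ∨ q.2.val = b.val + 1) then 1 else 0)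

/-- Destabilizer D^X_j: X-part the indicator of {0} × {j,…,n−1}. -/
def DX {m n : ℕ} (j : Fin (n - 1)) : V m n :=
  (fun q => if q.1.val = 0 ∧ j.val + 1 ≤ q.2.val then 1 else 0, 0)

/-- Destabilizer D^Z_i: Z-part the indicator of {i,…,m−1} × {0}. -/
def DZ {m n : ℕ} (i : Fin (m - 1)) : V m n :=
  (0, fun q => if i.val + 1 ≤ q.1.val ∧ q.2.val = 0 then 1 else 0)


/-- The Pauli vector whose X-support depends only on the first coordinate (through `f`) and whose
Z-support depends only on the second one (through `g`). -/
def lineMap (m n : ℕ) :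
    ((Fin m → ZMod 2) × (Fin n → ZMod 2)) →ₗ[ZMod 2] V m n :=
  (LinearMap.funLeft (ZMod 2) (ZMod 2) Prod.fst).prodMap
    (LinearMap.funLeft (ZMod 2) (ZMod 2) Prod.snd)

theorem lineMap_apply {m n : ℕ} (f : Fin m → ZMod 2) (g : Fin n → ZMod 2) :
    lineMap m n (f, g) = (fun q => f q.1, fun q => g q.2) := rfl

theorem lineMap_injective {m n : ℕ} [NeZero m] [NeZero n] :
    Function.Injective (lineMap m n) := by
  rintro ⟨f, g⟩ ⟨f', g'⟩ h
  simp only [lineMap_apply, Prod.mk.injEq] at h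
  refine Prod.ext (funext fun i => ?_) (funext fun j => ?_)
  · exact congrFun h.1 (i, 0)
  · exact congrFun h.2 (0, j)

theorem finrank_range_lineMap {m n : ℕ} [NeZero m] [NeZero n] :
    Module.finrank (ZMod 2) (LinearMap.range (lineMap m n)) = m + n := by
  rw [LinearMap.finrank_range_of_inj lineMap_injective]
  simp

theorem sum_ite_adjacent_row {m n : ℕ} (a : Fin m × Fin n → ZMod 2) (i : Fin (m - 1))
    (j : Fin n) :
    ∑ q : Fin m × Fin n,
        a q * (if (q.1.val = i.val ∨ q.1.val = i.val + 1) ∧ q.2 = j then 1 else 0) =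
      a (⟨i, by omega⟩, j) + a (⟨i + 1, by omega⟩, j) := by
  have hne : ((⟨i, by omega⟩, j) : Fin m × Fin n) ≠ (⟨i + 1, by omega⟩, j) := by simp
  rw [← Finset.sum_pair hne]
  simp only [mul_ite, mul_one, mul_zero, ← Finset.sum_filter]
  refine Finset.sum_congr ?_ fun _ _ => rfl
  ext ⟨x, y⟩
  simp [Fin.ext_iff]
  tauto

theorem sum_ite_adjacent_column {m n : ℕ} (a : Fin m × Fin n → ZMod 2) (i : Fin m)
    (j : Fin (n - 1)) :
    ∑ q : Fin m × Fin n,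
        a q * (if q.1 = i ∧ (q.2.val = j.val ∨ q.2.val = j.val + 1) then 1 else 0) =
      a (i, ⟨j, by omega⟩) + a (i, ⟨j + 1, by omega⟩) := by
  have hne : ((i, ⟨j, by omega⟩) : Fin m × Fin n) ≠ (i, ⟨j + 1, by omega⟩) := by simp
  rw [← Finset.sum_pair hne]
  simp only [mul_ite, mul_one, mul_zero, ← Finset.sum_filter]
  refine Finset.sum_congr ?_ fun _ _ => rfl
  ext ⟨x, y⟩
  simp [Fin.ext_iff]
  tauto

theorem omega_Hcheck {m n : ℕ} (v : V m n) (i : Fin (m - 1)) (j : Fin n) :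
    omega v (Hcheck i j) = v.2 (⟨i, by omega⟩, j) + v.2 (⟨i + 1, by omega⟩, j) := by
  rw [← sum_ite_adjacent_row]
  simp [omega, Hcheck]

theorem omega_Wcheck {m n : ℕ} (v : V m n) (i : Fin m) (j : Fin (n - 1)) :
    omega v (Wcheck i j) = v.1 (i, ⟨j, by omega⟩) + v.1 (i, ⟨j + 1, by omega⟩) := by
  rw [← sum_ite_adjacent_column]
  simp [omega, Wcheck]

theorem omega_comm {m n : ℕ} (v w : V m n) : omega v w = omega w v := by
  simp only [omega, add_comm]

theorem mem_centralizer_iff {m n : ℕ} (v : V m n) :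
    v ∈ centralizer m n ↔
      (∀ i j, omega v (Hcheck i j) = 0) ∧ ∀ i j, omega v (Wcheck i j) = 0 := by
  simp only [centralizer, Submodule.mem_iInf, LinearMap.mem_ker]
  constructor
  · intro h
    exact ⟨fun i j => h _ (Submodule.subset_span (Or.inl ⟨(i, j), rfl⟩)),
      fun i j => h _ (Submodule.subset_span (Or.inr ⟨(i, j), rfl⟩))⟩
  · rintro ⟨hH, hW⟩ w hw
    have hle : checkSpan m n ≤ LinearMap.ker (omegaR v) := by
      refine Submodule.span_le.2 ?_
      rintro _ (⟨⟨i, j⟩, rfl⟩ | ⟨⟨i, j⟩, rfl⟩)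
      · exact (omega_comm _ _).trans (hH i j)
      · exact (omega_comm _ _).trans (hW i j)
    exact (omega_comm _ _).trans (hle hw)

theorem apply_eq_apply_zero_of_adjacent_eq {m : ℕ} [NeZero m] {α : Type*} (f : Fin m → α)
    (h : ∀ i : Fin (m - 1), f ⟨i, by omega⟩ = f ⟨i + 1, by omega⟩) (x : Fin m) :
    f x = f 0 := by
  obtain ⟨k, hk⟩ := x
  induction k with
  | zero => rfl
  | succ k ih => exact (h ⟨k, by omega⟩).symm.trans (ih (by omega))

theorem centralizer_eq_range_lineMap {m n : ℕ} [NeZero m] [NeZero n] :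
    centralizer m n = LinearMap.range (lineMap m n) := by
  ext v
  simp only [mem_centralizer_iff, omega_Hcheck, omega_Wcheck, CharTwo.add_eq_zero]
  constructor
  · rintro ⟨hH, hW⟩
    refine ⟨(fun i => v.1 (i, 0), fun j => v.2 (0, j)), ?_⟩
    rw [lineMap_apply]
    refine Prod.ext (funext fun q => ?_) (funext fun q => ?_)
    · exact (apply_eq_apply_zero_of_adjacent_eq (fun j => v.1 (q.1, j)) (hW q.1) q.2).symm
    · exact (apply_eq_apply_zero_of_adjacent_eq (fun i => v.2 (i, q.2)) (fun i => hH i q.2) q.1).symm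
  · rintro ⟨⟨f, g⟩, rfl⟩
    simp [lineMap_apply]

/-- A submodule containing the images of the indicator of `{0}` and of all indicators of
`{i, i + 1}` contains the image of every vector. -/
theorem map_mem_of_adjacent_mem {m : ℕ} {M : Type*} [AddCommGroup M] [Module (ZMod 2) M]
    (T : (Fin m → ZMod 2) →ₗ[ZMod 2] M) (S : Submodule (ZMod 2) M)
    (h_zero : T (fun q => if q.val = 0 then 1 else 0) ∈ S)
    (h_pair : ∀ i : Fin (m - 1),
      T (fun q => if q.val = i.val ∨ q.val = i.val + 1 then 1 else 0) ∈ S)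
    (f : Fin m → ZMod 2) : T f ∈ S := by
  have h_ind : ∀ k, k < m → T (fun q => if q.val = k then 1 else 0) ∈ S := by
    intro k
    induction k with
    | zero => exact fun _ => h_zero
    | succ k ih =>
      intro hk
      have h := S.sub_mem (h_pair ⟨k, by omega⟩) (ih (by omega))
      rw [← map_sub] at h
      convert h using 2
      ext q
      by_cases h₁ : q.val = k <;> by_cases h₂ : q.val = k + 1 <;> simp [h₁, h₂]
  have hf : f =
      ∑ k : Fin m, f k • (fun q : Fin m => if q.val = k.val then (1 : ZMod 2) else 0) := by
    ext q
    simp [Finset.sum_apply, ← Fin.ext_iff]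
  rw [hf, map_sum]
  refine S.sum_mem fun k _ => ?_
  rw [map_smul]
  exact S.smul_mem _ (h_ind k k.isLt)

theorem span_eq_range_lineMap (m n : ℕ) :
    Submodule.span (ZMod 2)
      (Set.range (SX (m := m) (n := n)) ∪ Set.range (SZ (m := m) (n := n)) ∪
        {XL (m := m) (n := n), ZL (m := m) (n := n)}) = LinearMap.range (lineMap m n) := by
  apply le_antisymm
  · refine Submodule.span_le.2 ?_
    rintro _ ((⟨i, rfl⟩ | ⟨j, rfl⟩) | rfl | rfl)
    · exact ⟨(fun x => if x.val = i.val ∨ x.val = i.val + 1 then 1 else 0, 0), rfl⟩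
    · exact ⟨(0, fun x => if x.val = j.val ∨ x.val = j.val + 1 then 1 else 0), rfl⟩
    · exact ⟨(fun x => if x.val = 0 then 1 else 0, 0), rfl⟩
    · exact ⟨(0, fun x => if x.val = 0 then 1 else 0), rfl⟩
  · rintro _ ⟨⟨f, g⟩, rfl⟩
    rw [← Prod.fst_add_snd (f, g), map_add]
    refine Submodule.add_mem _ ?_ ?_
    · refine map_mem_of_adjacent_mem (lineMap m n ∘ₗ LinearMap.inl _ _ _) _ ?_ (fun i => ?_) f
      · exact Submodule.subset_span (Or.inr (Or.inl rfl))
      · exact Submodule.subset_span (Or.inl (Or.inl ⟨i, rfl⟩))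
    · refine map_mem_of_adjacent_mem (lineMap m n ∘ₗ LinearMap.inr _ _ _) _ ?_ (fun j => ?_) g
      · exact Submodule.subset_span (Or.inr (Or.inr rfl))
      · exact Submodule.subset_span (Or.inl (Or.inr ⟨j, rfl⟩))

/-- The centralizer of the check span equals the span of the m+n vectors
S^X_1,…,S^X_{m−1}, S^Z_1,…,S^Z_{n−1}, X̄_L, Z̄_L, which are linearly independent. -/
theorem stmt6 (m n : ℕ) (hm : 2 ≤ m) (hn : 2 ≤ n) :
    centralizer m n = Submodule.span (ZMod 2)
      (Set.range (SX (m := m) (n := n)) ∪ Set.range (SZ (m := m) (n := n)) ∪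
        {XL (m := m) (n := n), ZL (m := m) (n := n)}) ∧
    LinearIndependent (ZMod 2)
      (Sum.elim (Sum.elim (SX (m := m) (n := n)) (SZ (m := m) (n := n)))
        (fun b : Bool => if b then XL (m := m) (n := n) else ZL (m := m) (n := n))) := by
  have : NeZero m := ⟨by omega⟩
  have : NeZero n := ⟨by omega⟩
  refine ⟨centralizer_eq_range_lineMap.trans (span_eq_range_lineMap m n).symm, ?_⟩
  rw [linearIndependent_iff_card_eq_finrank_span, Set.finrank, Set.Sum.elim_range,
    Set.Sum.elim_range]
  have h_range : (Set.range fun b : Bool => if b then XL (m := m) (n := n) else ZL) = {XL, ZL} := by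
    ext v
    simp [or_comm]
  rw [h_range, span_eq_range_lineMap, finrank_range_lineMap]
  simp only [Fintype.card_sum, Fintype.card_fin, Fintype.card_bool]
  omega
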